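/- Let F be the free Lie algebra over a field K of characteristic zero on three generators x₁, x₂, x₃, and let R be the Lie ideal of F generated by the element ⁅x₂, x₃⁆ together with F³, the third term of the lower central series of F (so that F/R is the Lie algebra L₅,₈ with presentation ⁅x₁,x₂⁆ = x₄, ⁅x₁,x₃⁆ = x₅). Then the quotient (R ∩ F³)/⁅⁅R, F⁆, F⁆ = F³/⁅⁅R, F⁆, F⁆, which is the 2-nilpotent multiplier of L₅,₈, is an abelian Lie algebra of dimension 18. -/

import Mathlib

universe u v

/-- The 2-nilpotent multiplier `(R ∩ F³) / ⁅⁅R, F⁆, F⁆` associated to a Lie ideal `R` of a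
Lie algebra `F` (intended: `F` a free Lie algebra and `F/R ≅ L` a free presentation of `L`).
Here `F³ = LieModule.lowerCentralSeries K F F 2` is the third term of the lower central
series of `F` (indexing in Mathlib starts at `0` with `F¹ = F`). -/
abbrev twoNilpotentMultiplier (K F : Type*) [Field K] [LieRing F] [LieAlgebra K F]
    (R : LieIdeal K F) : Type _ :=
  (↥((R ⊓ LieModule.lowerCentralSeries K F F 2 : LieIdeal K F) : Submodule K F)) ⧸
    (Submodule.comap
      ((R ⊓ LieModule.lowerCentralSeries K F F 2 : LieIdeal K F) : Submodule K F).subtype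
      ((⁅⁅R, (⊤ : LieIdeal K F)⁆, (⊤ : LieIdeal K F)⁆ : LieIdeal K F) : Submodule K F))

namespace TwoNilp

section
variable (K : Type*) [Field K]

/-- free Lie algebra on three generators -/
abbrev FL := FreeLieAlgebra K (Fin 3)

/-- lower central series -/
noncomputable abbrev LC (n : ℕ) : LieIdeal K (FL K) := LieModule.lowerCentralSeries K (FL K) (FL K) n

/-- generators -/
noncomputable abbrev gx (i : Fin 3) : FL K := FreeLieAlgebra.of K i

variable {K}

theorem LC_succ (n : ℕ) : LC K (n + 1) = ⁅(⊤ : LieIdeal K (FL K)), LC K n⁆ :=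
  LieModule.lowerCentralSeries_succ K (FL K) (FL K) n

theorem lie_mem_LC {n : ℕ} {u : FL K} (hu : u ∈ LC K n) (v : FL K) : ⁅u, v⁆ ∈ LC K (n + 1) := by
  rw [← lie_skew, LC_succ]
  exact neg_mem (LieSubmodule.lie_mem_lie (LieSubmodule.mem_top v) hu)

theorem LC_anti (n : ℕ) : LC K (n + 1) ≤ LC K n := by
  rw [LC_succ]
  exact LieSubmodule.lie_le_right _ _

theorem LC_succ_le {n : ℕ} {W : Submodule K (FL K)}
    (h : ∀ u : FL K, ∀ v ∈ LC K n, ⁅u, v⁆ ∈ W) : (LC K (n + 1)).toSubmodule ≤ W := by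
  rw [LC_succ, LieSubmodule.lieIdeal_oper_eq_linear_span',
    Submodule.span_le]
  rintro _ ⟨u, -, v, hv, rfl⟩
  exact h u v hv

theorem lie_mem_LC_two {n : ℕ} {u : FL K} (hu : u ∈ LC K n) {v : FL K} (hv : v ∈ LC K 1) :
    ⁅u, v⁆ ∈ LC K (n + 2) := by
  have : (LC K 1).toSubmodule ≤
      (LC K (n + 2)).toSubmodule.comap (LieModule.toEnd K (FL K) (FL K) u) := by
    apply LC_succ_le
    intro a b _
    change ⁅u, ⁅a, b⁆⁆ ∈ LC K (n + 2)
    rw [leibniz_lie]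
    refine add_mem (lie_mem_LC (lie_mem_LC hu a) b) ?_
    rw [← lie_skew]
    exact neg_mem (lie_mem_LC (lie_mem_LC hu b) a)
  exact this hv

theorem mem_of_gen (S : LieSubalgebra K (FL K)) (hS : ∀ i, gx K i ∈ S) (f : FL K) : f ∈ S := by
  let g : FL K →ₗ⁅K⁆ S := FreeLieAlgebra.lift K (fun i => (⟨gx K i, hS i⟩ : S))
  have h : S.incl.comp g = LieHom.id := by
    ext i
    simp [g]
  have h2 : S.incl (g f) = f := by
    have := congrArg (fun t => t f) h
    simpa using this
  rw [← h2]
  exact (g f).2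

theorem top_le_gen (f : FL K) :
    f ∈ Submodule.span K (Set.range (gx K)) ⊔ (LC K 1).toSubmodule := by
  let S : LieSubalgebra K (FL K) :=
    { (Submodule.span K (Set.range (gx K)) ⊔ (LC K 1).toSubmodule) with
      lie_mem' := by
        intro a b _ _
        refine Submodule.mem_sup_right ?_
        exact lie_mem_LC (n := 0) (by simp [LC]) b }
  have hS : ∀ i, gx K i ∈ S := fun i =>
    Submodule.mem_sup_left (Submodule.subset_span ⟨i, rfl⟩)
  exact mem_of_gen S hS f

theorem bracket_step (I : LieIdeal K (FL K)) (D : Set (FL K)) (n : ℕ)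
    (hD : ∀ d ∈ D, d ∈ LC K n)
    (hI : I.toSubmodule ≤ Submodule.span K D ⊔ (LC K (n + 1)).toSubmodule) :
    (⁅I, (⊤ : LieIdeal K (FL K))⁆ : LieIdeal K (FL K)).toSubmodule ≤
      Submodule.span K {e | ∃ d ∈ D, ∃ i, e = ⁅d, gx K i⁆} ⊔ (LC K (n + 2)).toSubmodule := by
  rw [LieSubmodule.lieIdeal_oper_eq_linear_span', Submodule.span_le]
  rintro _ ⟨m, hm, f, -, rfl⟩
  obtain ⟨a, ha, b, hb, rfl⟩ := Submodule.mem_sup.1 (hI hm)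
  obtain ⟨c, hc, g, hg, rfl⟩ := Submodule.mem_sup.1 (top_le_gen f)
  have haL : a ∈ LC K n := by
    have : Submodule.span K D ≤ (LC K n).toSubmodule := Submodule.span_le.2 hD
    exact this ha
  change ⁅a + b, c + g⁆ ∈ _
  rw [add_lie, lie_add]
  refine add_mem (add_mem ?_ (Submodule.mem_sup_right (lie_mem_LC_two haL hg)))
    (Submodule.mem_sup_right (lie_mem_LC hb _))
  refine Submodule.mem_sup_left ?_
  clear hm haL
  induction ha using Submodule.span_induction with
  | zero => simp
  | add u v _ _ hu hv => rw [add_lie]; exact add_mem hu hv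
  | smul t u _ hu => rw [smul_lie]; exact Submodule.smul_mem _ _ hu
  | mem d hd =>
    induction hc using Submodule.span_induction with
    | zero => simp
    | add u v _ _ hu hv => rw [lie_add]; exact add_mem hu hv
    | smul t u _ hu => rw [lie_smul]; exact Submodule.smul_mem _ _ hu
    | mem x hx =>
      obtain ⟨i, rfl⟩ := hx
      exact Submodule.subset_span ⟨d, hd, i, rfl⟩

/-- left-normed bracket of a word, stored in reverse order -/
noncomputable def lnr (K : Type*) [Field K] : List (Fin 3) → FL K
  | [] => 0
  | [a] => gx K a
  | a :: b :: l => ⁅lnr K (b :: l), gx K a⁆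

theorem lnr_cons (a : Fin 3) {l : List (Fin 3)} (h : l ≠ []) :
    lnr K (a :: l) = ⁅lnr K l, gx K a⁆ := by
  cases l with
  | nil => exact absurd rfl h
  | cons b l => rfl

theorem lnr_mem (l : List (Fin 3)) (n : ℕ) (h : l.length = n + 1) : lnr K l ∈ LC K n := by
  induction n generalizing l with
  | zero => simp [LC]
  | succ n ih =>
    match l, h with
    | a :: b :: l, h => exact lie_mem_LC (ih (b :: l) (by simpa using h)) _

theorem LC_le_span (n : ℕ) : (LC K n).toSubmodule ≤
    Submodule.span K {e | ∃ l : List (Fin 3), l.length = n + 1 ∧ e = lnr K l} ⊔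
      (LC K (n + 1)).toSubmodule := by
  induction n with
  | zero =>
    intro f _
    have h : Submodule.span K (Set.range (gx K)) ≤
        Submodule.span K {e | ∃ l : List (Fin 3), l.length = 0 + 1 ∧ e = lnr K l} := by
      apply Submodule.span_mono
      rintro _ ⟨i, rfl⟩
      exact ⟨[i], rfl, rfl⟩
    exact (sup_le_sup_right h (LC K 1).toSubmodule) (top_le_gen f)
  | succ n ih =>
    have := bracket_step (LC K n) _ n (by rintro _ ⟨l, hl, rfl⟩; exact lnr_mem l n hl) ih
    rw [LieSubmodule.lie_comm] at this
    rw [LC_succ]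
    refine this.trans (sup_le_sup_right (Submodule.span_mono ?_) _)
    rintro _ ⟨_, ⟨l, hl, rfl⟩, i, rfl⟩
    refine ⟨i :: l, by simp [hl], (lnr_cons i ?_).symm⟩
    rintro rfl
    simp at hl

end

/-- reversed words of the spanning elements -/
def wordsE : Fin 18 → List (Fin 3) :=
  ![[0, 0, 1],
    [1, 0, 1],
    [2, 0, 1],
    [0, 0, 2],
    [1, 0, 2],
    [2, 0, 2],
    [1, 1, 2],
    [2, 1, 2],
    [0, 0, 0, 1],
    [1, 0, 0, 1],
    [2, 0, 0, 1],
    [1, 1, 0, 1],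
    [2, 1, 0, 1],
    [2, 2, 0, 1],
    [0, 0, 0, 2],
    [1, 0, 0, 2],
    [2, 0, 0, 2],
    [2, 2, 0, 2]]

/-- diagonal values -/
def diagD : Fin 18 → ℤ :=
  ![1, 1, 1, 1, 1, 1, 1, 1, 1, 1, 2, 1, 1, 1, 1, 2, 1, 1]

/-- dual functionals -/
def tabT : Fin 18 → List (List (Fin 3) × ℤ) :=
  ![[([0, 0, 1], 1)],
    [([0, 1, 1], -1)],
    [([0, 1, 2], -1)],
    [([0, 0, 2], 1)],
    [([0, 2, 1], -1)],
    [([0, 2, 2], -1)],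
    [([1, 1, 2], 1)],
    [([1, 2, 2], -1)],
    [([0, 0, 0, 1], -1)],
    [([0, 0, 1, 1], 1)],
    [([0, 1, 0, 2], -1)],
    [([0, 1, 1, 1], -1)],
    [([0, 1, 1, 2], -1), ([0, 1, 2, 1], -1), ([0, 2, 1, 1], -1)],
    [([0, 1, 2, 2], -1), ([0, 2, 1, 2], -1), ([0, 2, 2, 1], -1)],
    [([0, 0, 0, 2], -1)],
    [([0, 0, 1, 2], 2), ([0, 0, 2, 1], 2), ([0, 1, 0, 2], 1)],
    [([0, 0, 2, 2], 1)],
    [([0, 2, 2, 2], -1)]]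


/-- signed word expansion of a left-normed bracket -/
def expW : List (Fin 3) → List (List (Fin 3) × ℤ)
  | [] => []
  | [a] => [([a], 1)]
  | a :: b :: l => (expW (b :: l)).flatMap (fun p => [(p.1 ++ [a], p.2), (a :: p.1, -p.2)])

/-- value of a functional on a left-normed bracket -/
def valT (T : List (List (Fin 3) × ℤ)) (l : List (Fin 3)) : ℤ :=
  (T.map (fun q => q.2 * ((expW l).map (fun p => if p.1 = q.1 then p.2 else 0)).sum)).sum

section
variable (K : Type*) [Field K]

attribute [local instance] LieRing.ofAssociativeRing

/-- the map to the tensor algebra -/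
noncomputable def toMA : FL K →ₗ⁅K⁆ MonoidAlgebra K (FreeMonoid (Fin 3)) :=
  FreeLieAlgebra.lift K (fun i => MonoidAlgebra.single (FreeMonoid.of i) (1 : K))

/-- a word as a tensor -/
noncomputable def sg (l : List (Fin 3)) : MonoidAlgebra K (FreeMonoid (Fin 3)) :=
  MonoidAlgebra.single (FreeMonoid.ofList l) (1 : K)

theorem sg_mul (l m : List (Fin 3)) : sg K l * sg K m = sg K (l ++ m) := by
  simp [sg, MonoidAlgebra.single_mul_single, FreeMonoid.ofList_append]

theorem toMA_gx (i : Fin 3) : toMA K (gx K i) = sg K [i] := by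
  simp [toMA, sg]

theorem toMA_lnr (l : List (Fin 3)) :
    toMA K (lnr K l) = ((expW l).map (fun p => (p.2 : K) • sg K p.1)).sum := by
  induction l with
  | nil => simp [lnr, expW]
  | cons a l ih =>
    match l, ih with
    | [], _ => simp [lnr, expW, toMA_gx]
    | b :: l, ih =>
      rw [lnr, expW, LieHom.map_lie, ih, toMA_gx, LieRing.of_associative_ring_bracket]
      generalize expW (b :: l) = M
      induction M with
      | nil => simp
      | cons p M ihM =>
        simp only [List.map_cons, List.sum_cons, List.flatMap_cons,
          ← ihM, add_mul, mul_add, smul_mul_assoc,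
          mul_smul_comm, sg_mul, Int.cast_neg, neg_smul, List.cons_append, List.nil_append]
        abel

/-- coefficient of a word -/
noncomputable def ev (w : List (Fin 3)) : FL K →ₗ[K] K where
  toFun f := (toMA K f).coeff (FreeMonoid.ofList w)
  map_add' := by intro a b; simp
  map_smul' := by intro a b; simp

theorem coeff_sg (w l : List (Fin 3)) :
    (sg K l).coeff (FreeMonoid.ofList w) = if l = w then 1 else 0 := by
  classical
  rw [sg, MonoidAlgebra.coeff_single, Finsupp.single_apply]
  simp

theorem ev_lnr (w l : List (Fin 3)) :
    ev K w (lnr K l) =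
      ((((expW l).map (fun p => if p.1 = w then p.2 else 0)).sum : ℤ) : K) := by
  change (toMA K (lnr K l)).coeff (FreeMonoid.ofList w) = _
  rw [toMA_lnr]
  generalize expW l = M
  induction M with
  | nil => simp
  | cons p M ih =>
    simp only [List.map_cons, List.sum_cons, MonoidAlgebra.coeff_add, Finsupp.add_apply, ih,
      MonoidAlgebra.coeff_smul, Finsupp.smul_apply, coeff_sg]
    split_ifs <;> simp

theorem support_LC (n : ℕ) (f : FL K) (hf : f ∈ LC K n) (w : FreeMonoid (Fin 3))
    (hw : (toMA K f).coeff w ≠ 0) : n + 1 ≤ w.length := by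
  classical
  let V (m : ℕ) : Submodule K (FL K) :=
    ⨅ w : {w : FreeMonoid (Fin 3) // w.length ≤ m}, LinearMap.ker (ev K w.1.toList)
  have hV : ∀ m f, f ∈ V m ↔ ∀ w, (toMA K f).coeff w ≠ 0 → m + 1 ≤ w.length := by
    intro m f
    simp only [V, Submodule.mem_iInf, LinearMap.mem_ker, Subtype.forall]
    constructor
    · intro h w hw
      by_contra hlt
      exact hw (h w (by omega))
    · intro h w hw
      by_contra hne
      have := h w hne
      omega
  have hmul : ∀ a b (u v : FL K), u ∈ V a → v ∈ V b → ∀ w,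
      (toMA K u * toMA K v).coeff w ≠ 0 → a + b + 2 ≤ w.length := by
    intro a b u v hu hv w hw
    have h := MonoidAlgebra.support_coeff_mul_subset _ _ (Finsupp.mem_support_iff.2 hw)
    obtain ⟨p, hp, q, hq, rfl⟩ := Finset.mem_mul.1 h
    have h1 := (hV a u).1 hu p (Finsupp.mem_support_iff.1 hp)
    have h2 := (hV b v).1 hv q (Finsupp.mem_support_iff.1 hq)
    rw [FreeMonoid.length_mul]
    omega
  have hlie : ∀ a b (u v : FL K), u ∈ V a → v ∈ V b → ⁅u, v⁆ ∈ V (a + b + 1) := by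
    intro a b u v hu hv
    rw [hV]
    intro w hw
    rw [LieHom.map_lie, LieRing.of_associative_ring_bracket] at hw
    by_cases h1 : (toMA K u * toMA K v).coeff w = 0
    · by_cases h2 : (toMA K v * toMA K u).coeff w = 0
      · exact absurd (by simp [h1, h2]) hw
      · have := hmul b a v u hv hu w h2
        omega
    · have := hmul a b u v hu hv w h1
      omega
  have h0 : ∀ f, f ∈ V 0 := by
    intro f
    let S : LieSubalgebra K (FL K) :=
      { V 0 with
        lie_mem' := by
          intro a b ha hb
          have := hlie 0 0 a b ha hb
          rw [hV] at this
          change _ ∈ V 0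
          rw [hV]
          intro w hw
          have := this w hw
          omega }
    have hS : ∀ i, gx K i ∈ S := by
      intro i
      change _ ∈ V 0
      rw [hV]
      intro w hw
      rw [toMA_gx, show w = FreeMonoid.ofList w.toList from rfl, coeff_sg] at hw
      have h : [i] = w.toList := by
        by_contra h
        simp [h] at hw
      have h' : w.length = w.toList.length := rfl
      rw [h', ← h]
      simp
    exact mem_of_gen S hS f
  have key : ∀ n, (LC K n).toSubmodule ≤ V n := by
    intro n
    induction n with
    | zero => intro f _; exact h0 f
    | succ n ih =>
      apply LC_succ_le
      intro u v hv
      have := hlie 0 n u v (h0 u) (ih hv)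
      simpa using this
  exact (hV n f).1 (key n hf) w hw

/-- functional from a table -/
noncomputable def funT (T : List (List (Fin 3) × ℤ)) : FL K →ₗ[K] K :=
  (T.map (fun q => (q.2 : K) • ev K q.1)).sum

theorem funT_lnr (T : List (List (Fin 3) × ℤ)) (l : List (Fin 3)) :
    funT K T (lnr K l) = ((valT T l : ℤ) : K) := by
  unfold funT valT
  induction T with
  | nil => simp
  | cons q T ih =>
    simp only [List.map_cons, List.sum_cons, LinearMap.add_apply, ih, LinearMap.smul_apply, ev_lnr]
    push_cast
    simp

theorem funT_LC (T : List (List (Fin 3) × ℤ)) (hT : ∀ q ∈ T, q.1.length ≤ 4) (f : FL K)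
    (hf : f ∈ LC K 4) : funT K T f = 0 := by
  unfold funT
  induction T with
  | nil => simp
  | cons q T ih =>
    have h1 : ev K q.1 f = 0 := by
      by_contra h
      have h5 := support_LC K 4 f hf _ h
      have h4 := hT q (by simp)
      have : (FreeMonoid.ofList q.1).length = q.1.length := rfl
      omega
    simp only [List.map_cons, List.sum_cons, LinearMap.add_apply, LinearMap.smul_apply, h1]
    rw [ih (fun q hq => hT q (by simp [hq]))]
    simp

end

section
variable {K : Type*} [Field K] [CharZero K]

theorem sub_mem_left (W : Submodule K (FL K)) {u v : FL K} (hv : v ∈ W) (h : u - v ∈ W) :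
    u ∈ W := by
  have := add_mem h hv
  rwa [sub_add_cancel] at this

theorem forall_three {Q : Fin 3 → Prop} (h0 : Q 0) (h1 : Q 1) (h2 : Q 2) (i : Fin 3) : Q i := by
  fin_cases i
  · exact h0
  · exact h1
  · exact h2

theorem forall_pair {Q : Fin 3 → Fin 3 → Prop} (hs : ∀ a, Q a a) (hc : ∀ a b, Q a b → Q b a)
    (h10 : Q 1 0) (h20 : Q 2 0) (h21 : Q 2 1) (a b : Fin 3) : Q a b :=
  forall_three (Q := fun a => ∀ b, Q a b)
    (forall_three (hs 0) (hc _ _ h10) (hc _ _ h20))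
    (forall_three h10 (hs 1) (hc _ _ h21))
    (forall_three h20 h21 (hs 2)) a b

theorem lnr_three_mem (W : Submodule K (FL K)) (hE : ∀ i, lnr K (wordsE i) ∈ W)
    (a b c : Fin 3) : lnr K [c, b, a] ∈ W := by
  have anti : ∀ a b c, lnr K [c, b, a] = - lnr K [c, a, b] := by
    intro a b c
    simp only [lnr]
    rw [← lie_skew (gx K a) (gx K b), neg_lie]
  have self : ∀ a c, lnr K [c, a, a] = 0 := by
    intro a c
    simp [lnr]
  have jac : lnr K [0, 1, 2] = lnr K [1, 0, 2] - lnr K [2, 0, 1] := by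
    simp only [lnr]
    rw [lie_lie, ← lie_skew (gx K 2) ⁅gx K 1, gx K 0⁆, ← lie_skew (gx K 1) ⁅gx K 2, gx K 0⁆]
    abel
  have h210 : lnr K [0, 1, 2] ∈ W := by
    rw [jac]
    exact sub_mem (hE 4) (hE 2)
  have hgood : ∀ c, lnr K [c, 0, 1] ∈ W ∧ lnr K [c, 0, 2] ∈ W ∧ lnr K [c, 1, 2] ∈ W := by
    exact forall_three ⟨hE 0, hE 3, h210⟩ ⟨hE 1, hE 4, hE 6⟩ ⟨hE 2, hE 5, hE 7⟩
  obtain ⟨h1, h2, h3⟩ := hgood c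
  have hneg : ∀ a b, lnr K [c, a, b] ∈ W → lnr K [c, b, a] ∈ W := by
    intro a b h
    rw [anti]
    exact neg_mem h
  have hself : ∀ a, lnr K [c, a, a] ∈ W := by
    intro a
    rw [self a c]
    exact zero_mem W
  exact forall_pair (Q := fun a b => lnr K [c, b, a] ∈ W) hself
    (fun a b h => hneg b a h) h1 h2 h3 a b

theorem lnr_four_mem (W : Submodule K (FL K)) (hE : ∀ i, lnr K (wordsE i) ∈ W)
    (hJ : ∀ i j, lnr K [j, i, 1, 2] ∈ W)
    (hJ2 : ∀ u v : FL K, ⁅⁅gx K 2, gx K 1⁆, ⁅u, v⁆⁆ ∈ W)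
    (a b c d : Fin 3) : lnr K [d, c, b, a] ∈ W := by
  have anti : ∀ a b c d, lnr K [d, c, b, a] = - lnr K [d, c, a, b] := by
    intro a b c d
    simp only [lnr]
    rw [← lie_skew (gx K a) (gx K b), neg_lie, neg_lie]
  have self : ∀ a c d, lnr K [d, c, a, a] = 0 := by
    intro a c d
    simp [lnr]
  have jac : ∀ a b c d, lnr K [d, c, b, a] - lnr K [c, d, b, a] =
      ⁅⁅gx K a, gx K b⁆, ⁅gx K c, gx K d⁆⁆ := by
    intro a b c d
    simp only [lnr]
    rw [leibniz_lie, ← lie_skew (gx K c) ⁅⁅gx K a, gx K b⁆, gx K d⁆]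
    abel
  have jac3 : ∀ d, lnr K [d, 0, 1, 2] = lnr K [d, 1, 0, 2] - lnr K [d, 2, 0, 1] := by
    intro d
    simp only [lnr]
    rw [← sub_lie]
    congr 1
    rw [lie_lie, ← lie_skew (gx K 2) ⁅gx K 1, gx K 0⁆, ← lie_skew (gx K 1) ⁅gx K 2, gx K 0⁆]
    abel
  have h1000 : lnr K [0, 0, 0, 1] ∈ W := hE 8
  have h1001 : lnr K [1, 0, 0, 1] ∈ W := hE 9
  have h1002 : lnr K [2, 0, 0, 1] ∈ W := hE 10
  have h1011 : lnr K [1, 1, 0, 1] ∈ W := hE 11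
  have h1012 : lnr K [2, 1, 0, 1] ∈ W := hE 12
  have h1022 : lnr K [2, 2, 0, 1] ∈ W := hE 13
  have h2000 : lnr K [0, 0, 0, 2] ∈ W := hE 14
  have h2001 : lnr K [1, 0, 0, 2] ∈ W := hE 15
  have h2002 : lnr K [2, 0, 0, 2] ∈ W := hE 16
  have h2022 : lnr K [2, 2, 0, 2] ∈ W := hE 17
  have h1010 : lnr K [0, 1, 0, 1] ∈ W := by
    have := jac 1 0 1 0
    rw [lie_self, sub_eq_zero] at this
    rwa [this]
  have h2020 : lnr K [0, 2, 0, 2] ∈ W := by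
    have := jac 2 0 2 0
    rw [lie_self, sub_eq_zero] at this
    rwa [this]
  have hy : ∀ a b, ⁅⁅gx K a, gx K b⁆, ⁅gx K 2, gx K 1⁆⁆ ∈ W := by
    intro a b
    rw [← lie_skew]
    exact neg_mem (hJ2 _ _)
  have h1021 : lnr K [1, 2, 0, 1] ∈ W := by
    have h := hy 1 0
    rw [← jac] at h
    exact sub_mem_left W h1012 h
  have hd : ∀ d, lnr K [d, 2, 0, 1] ∈ W → lnr K [d, 1, 0, 2] ∈ W := by
    intro d h
    have h2 := hJ 0 d
    rw [jac3] at h2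
    exact sub_mem_left W h h2
  have h2012 : lnr K [2, 1, 0, 2] ∈ W := hd 2 h1022
  have h2011 : lnr K [1, 1, 0, 2] ∈ W := hd 1 h1021
  have h2021 : lnr K [1, 2, 0, 2] ∈ W := by
    have h := hy 2 0
    rw [← jac] at h
    exact sub_mem_left W h2012 h
  have h1020 : lnr K [0, 2, 0, 1] ∈ W := by
    have e1 := jac 1 0 2 0
    have e2 := jac 2 0 1 0
    rw [← lie_skew, ← e2] at e1
    have e3 := jac3 0
    have h : (2 : K) • lnr K [0, 2, 0, 1] =
        lnr K [2, 0, 0, 1] + lnr K [1, 0, 0, 2] - lnr K [0, 0, 1, 2] := by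
      rw [two_smul, e3]
      have := sub_eq_iff_eq_add.1 e1
      nth_rewrite 1 [this]
      abel
    have hm : (2 : K) • lnr K [0, 2, 0, 1] ∈ W := by
      rw [h]
      exact sub_mem (add_mem h1002 h2001) (hJ 0 0)
    exact (Submodule.smul_mem_iff W (two_ne_zero)).1 hm
  have h2010 : lnr K [0, 1, 0, 2] ∈ W := hd 0 h1020
  have hgood : ∀ c d, lnr K [d, c, 0, 1] ∈ W ∧ lnr K [d, c, 0, 2] ∈ W := by
    exact forall_three
      (forall_three ⟨h1000, h2000⟩ ⟨h1001, h2001⟩ ⟨h1002, h2002⟩)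
      (forall_three ⟨h1010, h2010⟩ ⟨h1011, h2011⟩ ⟨h1012, h2012⟩)
      (forall_three ⟨h1020, h2020⟩ ⟨h1021, h2021⟩ ⟨h1022, h2022⟩)
  obtain ⟨h1, h2⟩ := hgood c d
  have h3 := hJ c d
  have hneg : ∀ a b, lnr K [d, c, a, b] ∈ W → lnr K [d, c, b, a] ∈ W := by
    intro a b h
    rw [anti]
    exact neg_mem h
  have hself : ∀ a, lnr K [d, c, a, a] ∈ W := by
    intro a
    rw [self a c d]
    exact zero_mem W
  exact forall_pair (Q := fun a b => lnr K [d, c, b, a] ∈ W) hself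
    (fun a b h => hneg b a h) h1 h2 h3 a b

theorem tab_diag : ∀ k i, valT (tabT k) (wordsE i) = if k = i then diagD i else 0 := by
  decide

theorem tab_kill : ∀ k i j, valT (tabT k) [j, i, 2, 1] = 0 := by
  decide

theorem tab_len : ∀ k, ∀ q ∈ tabT k, q.1.length ≤ 4 := by
  decide

theorem diag_ne : ∀ i, diagD i ≠ 0 := by
  decide

end

end TwoNilp

theorem stmt (K : Type*) [Field K] [CharZero K]
    (R : LieIdeal K (FreeLieAlgebra K (Fin 3)))
    (hR : R = LieSubmodule.lieSpan K (FreeLieAlgebra K (Fin 3))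
        {⁅FreeLieAlgebra.of K (1 : Fin 3), FreeLieAlgebra.of K 2⁆} ⊔
      LieModule.lowerCentralSeries K (FreeLieAlgebra K (Fin 3)) (FreeLieAlgebra K (Fin 3)) 2) :
    (∀ x y : FreeLieAlgebra K (Fin 3),
        x ∈ R ⊓ LieModule.lowerCentralSeries K (FreeLieAlgebra K (Fin 3)) (FreeLieAlgebra K (Fin 3)) 2 →
        y ∈ R ⊓ LieModule.lowerCentralSeries K (FreeLieAlgebra K (Fin 3)) (FreeLieAlgebra K (Fin 3)) 2 →
        ⁅x, y⁆ ∈ (⁅⁅R, (⊤ : LieIdeal K (FreeLieAlgebra K (Fin 3)))⁆, (⊤ : LieIdeal K (FreeLieAlgebra K (Fin 3)))⁆ : LieIdeal K (FreeLieAlgebra K (Fin 3)))) ∧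
    (R ⊓ LieModule.lowerCentralSeries K (FreeLieAlgebra K (Fin 3)) (FreeLieAlgebra K (Fin 3)) 2 =
      LieModule.lowerCentralSeries K (FreeLieAlgebra K (Fin 3)) (FreeLieAlgebra K (Fin 3)) 2) ∧
    FiniteDimensional K (twoNilpotentMultiplier K (FreeLieAlgebra K (Fin 3)) R) ∧
    Module.finrank K (twoNilpotentMultiplier K (FreeLieAlgebra K (Fin 3)) R) = 18 := by
  classical
  have hle : TwoNilp.LC K 2 ≤ R := by rw [hR]; exact le_sup_right
  have hinf : R ⊓ TwoNilp.LC K 2 = TwoNilp.LC K 2 := inf_eq_right.2 hle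
  set J : LieIdeal K (FreeLieAlgebra K (Fin 3)) :=
    ⁅⁅R, (⊤ : LieIdeal K (FreeLieAlgebra K (Fin 3)))⁆,
      (⊤ : LieIdeal K (FreeLieAlgebra K (Fin 3)))⁆ with hJdef
  have hyR : ⁅TwoNilp.gx K 1, TwoNilp.gx K 2⁆ ∈ R := by
    rw [hR]
    exact le_sup_left (α := LieIdeal K (FreeLieAlgebra K (Fin 3)))
      (LieSubmodule.subset_lieSpan (Set.mem_singleton _))
  have hRJ : ∀ r ∈ R, ∀ u v : FreeLieAlgebra K (Fin 3), ⁅⁅r, u⁆, v⁆ ∈ J := by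
    intro r hr u v
    exact LieSubmodule.lie_mem_lie (LieSubmodule.lie_mem_lie hr (LieSubmodule.mem_top u))
      (LieSubmodule.mem_top v)
  have hRJ2 : ∀ r ∈ R, ∀ u v : FreeLieAlgebra K (Fin 3), ⁅r, ⁅u, v⁆⁆ ∈ J := by
    intro r hr u v
    rw [leibniz_lie, ← lie_skew u]
    exact add_mem (hRJ r hr u v) (neg_mem (hRJ r hr v u))
  have hyR' : ⁅TwoNilp.gx K 2, TwoNilp.gx K 1⁆ ∈ R := by
    rw [← lie_skew]
    exact neg_mem hyR
  -- `F⁵` lies in `J`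
  have hL4 : TwoNilp.LC K 4 ≤ J := by
    rw [TwoNilp.LC_succ, TwoNilp.LC_succ, LieSubmodule.lie_comm, LieSubmodule.lie_comm (I := ⊤)]
    exact LieSubmodule.mono_lie_left _ (LieSubmodule.mono_lie_left _ hle)
  -- upper estimate of `J`
  have hRle : R.toSubmodule ≤ Submodule.span K {TwoNilp.lnr K [2, 1]} ⊔
      (TwoNilp.LC K 2).toSubmodule := by
    let I : LieIdeal K (FreeLieAlgebra K (Fin 3)) :=
      { Submodule.span K {TwoNilp.lnr K [2, 1]} ⊔ (TwoNilp.LC K 2).toSubmodule with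
        lie_mem := by
          intro u m hm
          refine Submodule.mem_sup_right ?_
          have hm1 : m ∈ (TwoNilp.LC K 1).toSubmodule := by
            refine (sup_le ?_ (TwoNilp.LC_anti 1) : _ ≤ (TwoNilp.LC K 1).toSubmodule) hm
            rw [Submodule.span_singleton_le_iff_mem]
            exact TwoNilp.lnr_mem [2, 1] 1 rfl
          rw [← lie_skew]
          exact neg_mem (TwoNilp.lie_mem_LC hm1 u) }
    have : R ≤ I := by
      rw [hR]
      refine sup_le ?_ ?_
      · rw [LieSubmodule.lieSpan_le]
        rintro _ rfl
        exact Submodule.mem_sup_left (Submodule.mem_span_singleton_self _)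
      · intro m hm
        exact Submodule.mem_sup_right hm
    exact this
  have hJle : J.toSubmodule ≤ Submodule.span K {e | ∃ i j, e = TwoNilp.lnr K [j, i, 2, 1]} ⊔
      (TwoNilp.LC K 4).toSubmodule := by
    have s1 := TwoNilp.bracket_step R _ 1
      (by rintro _ rfl; exact TwoNilp.lnr_mem [2, 1] 1 rfl) hRle
    have s2 := TwoNilp.bracket_step _ _ 2
      (by rintro _ ⟨_, rfl, i, rfl⟩; exact TwoNilp.lnr_mem [i, 2, 1] 2 rfl) s1
    refine s2.trans (sup_le_sup_right (Submodule.span_mono ?_) _)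
    rintro _ ⟨_, ⟨_, rfl, i, rfl⟩, j, rfl⟩
    exact ⟨i, j, rfl⟩
  -- spanning
  have hspan : (TwoNilp.LC K 2).toSubmodule ≤
      Submodule.span K (Set.range fun i => TwoNilp.lnr K (TwoNilp.wordsE i)) ⊔ J.toSubmodule := by
    set W := Submodule.span K (Set.range fun i => TwoNilp.lnr K (TwoNilp.wordsE i)) ⊔
      J.toSubmodule with hW
    have hE : ∀ i, TwoNilp.lnr K (TwoNilp.wordsE i) ∈ W := fun i =>
      Submodule.mem_sup_left (Submodule.subset_span ⟨i, rfl⟩)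
    refine (TwoNilp.LC_le_span 2).trans (sup_le ?_ ((TwoNilp.LC_le_span 3).trans (sup_le ?_ ?_)))
    · rw [Submodule.span_le]
      rintro _ ⟨l, hl, rfl⟩
      match l, hl with
      | [c, b, a], _ => exact TwoNilp.lnr_three_mem W hE a b c
    · rw [Submodule.span_le]
      rintro _ ⟨l, hl, rfl⟩
      match l, hl with
      | [d, c, b, a], _ =>
        exact TwoNilp.lnr_four_mem W hE
          (fun i j => Submodule.mem_sup_right (hRJ _ hyR' _ _))
          (fun u v => Submodule.mem_sup_right (hRJ2 _ hyR' _ _)) a b c d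
    · exact fun m hm => Submodule.mem_sup_right (hL4 hm)
  refine ⟨?_, hinf, ?_⟩
  · intro x y hx hy
    have h1 := TwoNilp.lie_mem_LC_two (K := K) hx.2 (TwoNilp.LC_anti 1 hy.2)
    exact hL4 h1
  -- the functionals
  let Φ : FreeLieAlgebra K (Fin 3) →ₗ[K] (Fin 18 → K) :=
    LinearMap.pi fun k => TwoNilp.funT K (TwoNilp.tabT k)
  have hΦJ : ∀ m ∈ J, Φ m = 0 := by
    have : J.toSubmodule ≤ LinearMap.ker Φ := by
      refine hJle.trans (sup_le ?_ ?_)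
      · rw [Submodule.span_le]
        rintro _ ⟨i, j, rfl⟩
        refine LinearMap.mem_ker.2 (funext fun k => ?_)
        change TwoNilp.funT K (TwoNilp.tabT k) _ = 0
        rw [TwoNilp.funT_lnr, TwoNilp.tab_kill, Int.cast_zero]
      · intro m hm
        refine LinearMap.mem_ker.2 (funext fun k => ?_)
        exact TwoNilp.funT_LC K _ (TwoNilp.tab_len k) m hm
    exact fun m hm => this hm
  set P : Submodule K (FreeLieAlgebra K (Fin 3)) :=
    ((R ⊓ TwoNilp.LC K 2 : LieIdeal K (FreeLieAlgebra K (Fin 3))) :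
      Submodule K (FreeLieAlgebra K (Fin 3))) with hP
  have hPE : ∀ i, TwoNilp.lnr K (TwoNilp.wordsE i) ∈ P := by
    intro i
    rw [hP, hinf]
    have h3 : ∀ i, (TwoNilp.wordsE i).length = 3 ∨ (TwoNilp.wordsE i).length = 4 := by decide
    rcases h3 i with h | h
    · exact TwoNilp.lnr_mem _ 2 h
    · exact TwoNilp.LC_anti 2 (TwoNilp.lnr_mem _ 3 h)
  let ψ : (Fin 18 → K) →ₗ[K] (P ⧸ Submodule.comap P.subtype J.toSubmodule) :=
    Fintype.linearCombination K (fun i => Submodule.Quotient.mk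
      (⟨TwoNilp.lnr K (TwoNilp.wordsE i), hPE i⟩ : P))
  let Ψ : (P ⧸ Submodule.comap P.subtype J.toSubmodule) →ₗ[K] (Fin 18 → K) :=
    Submodule.liftQ _ (Φ.comp P.subtype) (fun m hm => hΦJ _ hm)
  have hΨψ : ∀ a k, Ψ (ψ a) k = a k * (TwoNilp.diagD k : K) := by
    intro a k
    simp only [ψ, Fintype.linearCombination_apply, map_sum, map_smul, Finset.sum_apply,
      Pi.smul_apply, smul_eq_mul]
    have : ∀ i, Ψ (Submodule.Quotient.mk (⟨TwoNilp.lnr K (TwoNilp.wordsE i), hPE i⟩ : P)) k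
        = if k = i then (TwoNilp.diagD i : K) else 0 := by
      intro i
      change TwoNilp.funT K (TwoNilp.tabT k) (TwoNilp.lnr K (TwoNilp.wordsE i)) = _
      rw [TwoNilp.funT_lnr, TwoNilp.tab_diag]
      split_ifs <;> simp
    simp [this]
  have hinj : Function.Injective ψ := by
    rw [← LinearMap.ker_eq_bot, LinearMap.ker_eq_bot']
    intro a ha
    funext k
    have h := hΨψ a k
    rw [ha, map_zero] at h
    have hd : (TwoNilp.diagD k : K) ≠ 0 := Int.cast_ne_zero.2 (TwoNilp.diag_ne k)
    simpa [hd] using h.symm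
  have hsurj : Function.Surjective ψ := by
    intro q
    obtain ⟨⟨m, hm⟩, rfl⟩ := Submodule.Quotient.mk_surjective _ q
    have hm2 : m ∈ (TwoNilp.LC K 2).toSubmodule := by
      rw [hP, hinf] at hm
      exact hm
    obtain ⟨a, ha, b, hb, hab⟩ := Submodule.mem_sup.1 (hspan hm2)
    obtain ⟨c, hc⟩ := (Submodule.mem_span_range_iff_exists_fun K).1 ha
    refine ⟨c, ?_⟩
    have h1 : ψ c = Submodule.Quotient.mk
        (∑ i, c i • (⟨TwoNilp.lnr K (TwoNilp.wordsE i), hPE i⟩ : P)) := by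
      rw [← Submodule.mkQ_apply, map_sum]
      simp only [ψ, Fintype.linearCombination_apply, map_smul, Submodule.mkQ_apply]
    rw [h1, Submodule.Quotient.eq, Submodule.mem_comap]
    have h2 : P.subtype (∑ i, c i • (⟨TwoNilp.lnr K (TwoNilp.wordsE i), hPE i⟩ : P) - ⟨m, hm⟩)
        = -b := by
      rw [map_sub, map_sum]
      simp only [map_smul, Submodule.subtype_apply]
      rw [hc, ← hab]
      abel
    rw [h2]
    exact neg_mem hb
  let e := LinearEquiv.ofBijective ψ ⟨hinj, hsurj⟩
  refine ⟨Module.Finite.equiv e, ?_⟩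
  exact e.finrank_eq.symm.trans (by simp)
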